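/- There exist absolute constants C₀ > 0 and n₀ such that the following holds for all n ≥ n₀. Let G be sampled from SBM(n,k,p,q) with 0 < q < p ≤ 3/4, σ² ≥ C₀·log n/n, and largest cluster size s_max ≥ s̄. Independently of the edges, place each vertex of V into Y₂ with probability 1/8 and into W with probability 1/2 (and elsewhere otherwise). Sample h = ⌈√n·log n⌉ vertices u₁,…,u_h independently and uniformly at random from Y₂, let u be a sampled vertex maximizing N_W(u_i), and set s′ := (N_W(u) − q·|W|)/(p−q). Then with probability at least 1 − O(n^{−8}), it holds that 0.48·s_max ≤ s′ ≤ 0.52·s_max. -/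

import Mathlib

open MeasureTheory

noncomputable def bern (p : ℝ) : Measure Bool :=
  ENNReal.ofReal p • Measure.dirac true + ENNReal.ofReal (1 - p) • Measure.dirac false

noncomputable def sbm (n k : ℕ) (c : Fin n → Fin k) (p q : ℝ) :
    Measure ({e : Fin n × Fin n // e.1 < e.2} → Bool) :=
  Measure.pi fun e => bern (if c e.1.1 = c e.1.2 then p else q)

def clusterF {n k : ℕ} (c : Fin n → Fin k) (i : Fin k) : Finset (Fin n) :=
  Finset.univ.filter fun v => c v = i

def smax {n k : ℕ} (c : Fin n → Fin k) : ℕ :=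
  Finset.univ.sup fun i : Fin k => (clusterF c i).card

noncomputable def sigSBM (p q : ℝ) : ℝ :=
  max (Real.sqrt (p * (1 - p))) (Real.sqrt (q * (1 - q)))

noncomputable def sbar (n : ℕ) (p q : ℝ) : ℝ :=
  2 ^ 13 * Real.sqrt (p * (1 - q) * n) * Real.log n / (p - q)

def adjB {n : ℕ} (G : {e : Fin n × Fin n // e.1 < e.2} → Bool) (u v : Fin n) : Bool :=
  if h : u < v then G ⟨(u, v), h⟩ else if h' : v < u then G ⟨(v, u), h'⟩ else false

/-- `N_S(v)`: the number of neighbors of `v` in `S` (not counting `v` itself). -/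
def nbr {n : ℕ} (G : {e : Fin n × Fin n // e.1 < e.2} → Bool) (S : Finset (Fin n)) (v : Fin n) :
    ℕ :=
  (S.filter fun u => adjB G u v = true).card

/-- The measure on vertex labels: each vertex independently gets label `0` (i.e. is put in `Y₂`)
with probability `1/8`, label `1` (i.e. is put in `W`) with probability `1/2`, and label `2`
(elsewhere) with probability `3/8`. -/
noncomputable def labelM (n : ℕ) : Measure (Fin n → Fin 3) :=
  Measure.pi fun _ =>
    ((1 : ENNReal) / 8) • Measure.dirac 0 + ((1 : ENNReal) / 2) • Measure.dirac 1 +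
      ((3 : ENNReal) / 8) • Measure.dirac 2

/-- The set `Y₂` determined by the labels. -/
def Y2 {n : ℕ} (lab : Fin n → Fin 3) : Finset (Fin n) := Finset.univ.filter fun v => lab v = 0

/-- The set `W` determined by the labels. -/
def Wset {n : ℕ} (lab : Fin n → Fin 3) : Finset (Fin n) := Finset.univ.filter fun v => lab v = 1

/-- The uniform measure on a finite set `S` of vertices. -/
noncomputable def unifOn {n : ℕ} (S : Finset (Fin n)) : Measure (Fin n) :=
  ((S.card : ENNReal))⁻¹ • ∑ v ∈ S, Measure.dirac v

/-- The joint distribution of (vertex labels, the SBM graph, `h` vertices sampled independently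
and uniformly at random from `Y₂`), all three components independent given the labels. -/
noncomputable def estMeasure (n k h : ℕ) (c : Fin n → Fin k) (p q : ℝ) :
    Measure ((Fin n → Fin 3) × (({e : Fin n × Fin n // e.1 < e.2} → Bool) × (Fin h → Fin n))) :=
  (labelM n).bind fun lab =>
    ((sbm n k c p q).prod (Measure.pi fun _ : Fin h => unifOn (Y2 lab))).map (Prod.mk lab)

section Concentration

variable {ι : Type*} [Fintype ι] {X : ι → Type*} [∀ i, MeasurableSpace (X i)]

/-- The moment generating function of a centered Bernoulli variable. -/
lemma integral_exp_indicator_le {Y : Type*} [MeasurableSpace Y] (ν : Measure Y)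
    [IsProbabilityMeasure ν] {A : Set Y} (hA : MeasurableSet A) {l : ℝ} (hl : |l| ≤ 1) :
    ∫ y, Real.exp (l * (A.indicator 1 y - ν.real A)) ∂ν ≤ Real.exp (l ^ 2 * ν.real A) := by
  have hpt : ∀ y, Real.exp (l * (A.indicator 1 y - ν.real A)) =
      Real.exp (-(l * ν.real A)) * (1 + (Real.exp l - 1) * A.indicator (1 : Y → ℝ) y) := by
    intro y
    by_cases hy : y ∈ A
    · simp only [Set.indicator_of_mem hy, Pi.one_apply, mul_one, add_sub_cancel]
      rw [← Real.exp_add]; ring_nf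
    · simp [Set.indicator_of_notMem hy]
  have hind : Integrable (A.indicator (1 : Y → ℝ)) ν :=
    (integrable_const (1 : ℝ)).indicator hA
  simp_rw [hpt]
  rw [integral_const_mul, integral_add (integrable_const _) (hind.const_mul _),
    integral_const_mul, integral_indicator_one hA]
  simp only [integral_const, probReal_univ, smul_eq_mul, mul_one]
  calc _ ≤ Real.exp (-(l * ν.real A)) * Real.exp ((Real.exp l - 1) * ν.real A) := by
        gcongr
        linarith [Real.add_one_le_exp ((Real.exp l - 1) * ν.real A)]
    _ = Real.exp ((Real.exp l - 1 - l) * ν.real A) := by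
        rw [← Real.exp_add]; ring_nf
    _ ≤ _ := by
        gcongr
        exact (le_abs_self _).trans (Real.abs_exp_sub_one_sub_id_le hl)

/-- Chernoff's bound for the number of coordinates in `S` that fall into the sets `A i`. -/
lemma pi_measureReal_chernoff (μ : ∀ i, Measure (X i)) [∀ i, IsProbabilityMeasure (μ i)]
    (S : Finset ι) {A : ∀ i, Set (X i)} (hA : ∀ i, MeasurableSet (A i)) {l : ℝ} (hl : |l| ≤ 1)
    (t : ℝ) :
    (Measure.pi μ).real {x | t ≤ l * (∑ i ∈ S, (A i).indicator (1 : X i → ℝ) (x i) -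
      ∑ i ∈ S, (μ i).real (A i))} ≤
      Real.exp (l ^ 2 * ∑ i ∈ S, (μ i).real (A i) - t) := by
  classical
  set g : ∀ i, X i → ℝ := fun i y =>
    if i ∈ S then Real.exp (l * ((A i).indicator 1 y - (μ i).real (A i))) else 1 with hg
  have hprod : ∀ x : ∀ i, X i, Real.exp (1 * (l * (∑ i ∈ S, (A i).indicator (1 : X i → ℝ) (x i) -
      ∑ i ∈ S, (μ i).real (A i)))) = ∏ i, g i (x i) := by
    intro x
    simp only [hg]
    rw [Finset.prod_ite_mem, Finset.univ_inter, ← Real.exp_sum, one_mul,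
      ← Finset.sum_sub_distrib, Finset.mul_sum]
  have hgint : ∀ i, Integrable (g i) (μ i) := by
    intro i
    by_cases hi : i ∈ S
    · simp only [hg, hi, if_true]
      have hmeas : Measurable fun y =>
          Real.exp (l * ((A i).indicator (1 : X i → ℝ) y - (μ i).real (A i))) :=
        ((((measurable_one).indicator (hA i)).sub_const _).const_mul _).exp
      refine Integrable.of_bound hmeas.aestronglyMeasurable (Real.exp 1) (.of_forall fun y => ?_)
      rw [Real.norm_eq_abs, abs_of_pos (Real.exp_pos _)]
      gcongr
      refine (le_abs_self _).trans ?_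
      rw [abs_mul]
      refine mul_le_one₀ hl (abs_nonneg _) ?_
      have h0 : 0 ≤ (μ i).real (A i) := measureReal_nonneg
      have h1 : (μ i).real (A i) ≤ 1 := measureReal_le_one
      by_cases hy : y ∈ A i <;> simp [hy, abs_le] <;> linarith
    · simp only [hg, hi, if_false]
      exact integrable_const _
  have hint : Integrable (fun x : ∀ i, X i => ∏ i, g i (x i)) (Measure.pi μ) :=
    Integrable.fintype_prod_dep hgint
  have key := ProbabilityTheory.measure_ge_le_exp_mul_mgf (μ := Measure.pi μ)
    (X := fun x => l * (∑ i ∈ S, (A i).indicator (1 : X i → ℝ) (x i) -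
      ∑ i ∈ S, (μ i).real (A i))) t (zero_le_one) (by simpa only [hprod] using hint)
  refine key.trans ?_
  rw [ProbabilityTheory.mgf]
  simp_rw [hprod]
  rw [integral_fintype_prod_eq_prod]
  have hle : ∏ i, ∫ y, g i y ∂(μ i) ≤
      ∏ i, if i ∈ S then Real.exp (l ^ 2 * (μ i).real (A i)) else 1 := by
    refine Finset.prod_le_prod (fun i _ => integral_nonneg fun y => ?_) fun i _ => ?_
    · simp only [hg]; split_ifs <;> positivity
    · by_cases hi : i ∈ S
      · simpa only [hg, hi, if_true] using integral_exp_indicator_le (μ i) (hA i) hl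
      · simp [hg, hi]
  rw [Finset.prod_ite_mem, Finset.univ_inter, ← Real.exp_sum, ← Finset.mul_sum] at hle
  calc _ ≤ Real.exp (-1 * t) * Real.exp (l ^ 2 * ∑ i ∈ S, (μ i).real (A i)) := by gcongr
    _ = _ := by rw [← Real.exp_add]; ring_nf

lemma exp_one_sub_mul_log_le {n : ℕ} (hn : 0 < n) :
    Real.exp (1 - 10 * Real.log n) ≤ 3 / (n : ℝ) ^ 10 := by
  have hn' : (0 : ℝ) < n := by exact_mod_cast hn
  rw [Real.exp_sub, show 10 * Real.log n = Real.log ((n : ℝ) ^ 10) by simp [Real.log_pow],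
    Real.exp_log (by positivity)]
  gcongr
  exact Real.exp_one_lt_three.le

/-- A two-sided polynomial tail bound: deviations of order `√N * log n`, where `N ≥ 1` bounds the
mean. -/
lemma pi_measureReal_deviation (μ : ∀ i, Measure (X i)) [∀ i, IsProbabilityMeasure (μ i)]
    (S : Finset ι) {A : ∀ i, Set (X i)} (hA : ∀ i, MeasurableSet (A i)) {n : ℕ} (hn : 0 < n)
    {N τ : ℝ} (hN : 1 ≤ N) (hmean : ∑ i ∈ S, (μ i).real (A i) ≤ N)
    (hτ : 10 * Real.sqrt N * Real.log n ≤ τ) :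
    (Measure.pi μ).real {x | τ < |∑ i ∈ S, (A i).indicator (1 : X i → ℝ) (x i) -
      ∑ i ∈ S, (μ i).real (A i)|} ≤ 6 / (n : ℝ) ^ 10 := by
  have hsq : 1 ≤ Real.sqrt N := Real.one_le_sqrt.2 hN
  set r := Real.sqrt N with hr
  have hr0 : 0 < r := by linarith
  have hrN : r ^ 2 = N := Real.sq_sqrt (by linarith)
  have htail : ∀ l : ℝ, l = r⁻¹ ∨ l = -r⁻¹ →
      (Measure.pi μ).real {x | 10 * Real.log n ≤ l * (∑ i ∈ S,
        (A i).indicator (1 : X i → ℝ) (x i) - ∑ i ∈ S, (μ i).real (A i))} ≤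
        3 / (n : ℝ) ^ 10 := by
    intro l hl
    have habs : |l| = r⁻¹ := by
      rcases hl with rfl | rfl <;> simp [abs_of_pos hr0]
    refine (pi_measureReal_chernoff μ S hA (habs.le.trans (inv_le_one_of_one_le₀ hsq)) _).trans
      (le_trans ?_ (exp_one_sub_mul_log_le hn))
    gcongr
    rw [← sq_abs, habs, inv_pow, hrN, inv_mul_le_iff₀ (by linarith)]
    linarith
  have hsub : {x : ∀ i, X i | τ < |∑ i ∈ S, (A i).indicator (1 : X i → ℝ) (x i) -
      ∑ i ∈ S, (μ i).real (A i)|} ⊆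
      {x | 10 * Real.log n ≤ r⁻¹ * (∑ i ∈ S, (A i).indicator (1 : X i → ℝ) (x i) -
        ∑ i ∈ S, (μ i).real (A i))} ∪
      {x | 10 * Real.log n ≤ -r⁻¹ * (∑ i ∈ S, (A i).indicator (1 : X i → ℝ) (x i) -
        ∑ i ∈ S, (μ i).real (A i))} := by
    intro x hx
    simp only [Set.mem_ofPred_eq, Set.mem_union] at hx ⊢
    rcases lt_abs.1 hx with h | h
    · left
      rw [le_inv_mul_iff₀ hr0]; linarith
    · right
      rw [neg_mul, ← mul_neg, le_inv_mul_iff₀ hr0]; linarith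
  calc _ ≤ _ := measureReal_mono hsub
    _ ≤ _ := measureReal_union_le _ _
    _ ≤ 3 / (n : ℝ) ^ 10 + 3 / (n : ℝ) ^ 10 :=
        add_le_add (htail _ (.inl rfl)) (htail _ (.inr rfl))
    _ = _ := by ring

end Concentration

section Labels

/-- The law of the label of a single vertex. -/
noncomputable def vertexLabelM : Measure (Fin 3) :=
  ((1 : ENNReal) / 8) • Measure.dirac 0 + ((1 : ENNReal) / 2) • Measure.dirac 1 +
    ((3 : ENNReal) / 8) • Measure.dirac 2

lemma vertexLabelM_real_zero : vertexLabelM.real {0} = 1 / 8 := by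
  simp [vertexLabelM, measureReal_def]

lemma vertexLabelM_real_one : vertexLabelM.real {1} = 1 / 2 := by
  simp [vertexLabelM, measureReal_def]

instance : IsProbabilityMeasure vertexLabelM := by
  refine ⟨?_⟩
  have h : ((1 : ENNReal) / 8) + 1 / 2 + 3 / 8 = 1 := by
    rw [← ENNReal.toReal_eq_one_iff, ENNReal.toReal_add, ENNReal.toReal_add]
    · norm_num
    all_goals simp [ENNReal.div_eq_top]
  simpa [vertexLabelM] using h

instance (n : ℕ) : IsProbabilityMeasure (labelM n) :=
  inferInstanceAs (IsProbabilityMeasure (Measure.pi fun _ : Fin n => vertexLabelM))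

lemma labelM_real_deviation {n : ℕ} (hn : 0 < n) (T : Finset (Fin n)) (a : Fin 3) {τ : ℝ}
    (hτ : 10 * Real.sqrt n * Real.log n ≤ τ) :
    (labelM n).real {lab | τ < |((T.filter fun v => lab v = a).card : ℝ) -
      T.card * vertexLabelM.real {a}|} ≤ 6 / (n : ℝ) ^ 10 := by
  have h := pi_measureReal_deviation (fun _ : Fin n => vertexLabelM) T
    (A := fun _ => {a}) (fun _ => measurableSet_singleton a) hn (N := n) (τ := τ)
    (by exact_mod_cast hn) ?_ hτ
  · simp only [Finset.sum_const, nsmul_eq_mul] at h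
    have hcard : ∀ lab : Fin n → Fin 3, ∑ v ∈ T, ({a} : Set (Fin 3)).indicator (1 : Fin 3 → ℝ)
        (lab v) = (T.filter fun v => lab v = a).card := by
      intro lab
      simp [Set.indicator_apply]
    simp_rw [hcard] at h
    exact h
  · calc ∑ i ∈ T, vertexLabelM.real {a} ≤ ∑ i ∈ T, 1 := by gcongr; exact measureReal_le_one
      _ ≤ n := by simpa using T.card_le_univ

end Labels

section Graph

lemma bern_real_true {p : ℝ} (hp : 0 ≤ p) : (bern p).real {true} = p := by
  simp [bern, measureReal_def, hp]

lemma isProbabilityMeasure_bern {p : ℝ} (h0 : 0 ≤ p) (h1 : p ≤ 1) :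
    IsProbabilityMeasure (bern p) := by
  refine ⟨?_⟩
  simp [bern, ← ENNReal.ofReal_add h0 (sub_nonneg.2 h1)]

lemma isProbabilityMeasure_sbm {n k : ℕ} (c : Fin n → Fin k) {p q : ℝ} (hp0 : 0 ≤ p)
    (hp1 : p ≤ 1) (hq0 : 0 ≤ q) (hq1 : q ≤ 1) : IsProbabilityMeasure (sbm n k c p q) := by
  have : ∀ e : {e : Fin n × Fin n // e.1 < e.2},
      IsProbabilityMeasure (bern (if c e.1.1 = c e.1.2 then p else q)) := by
    intro e
    split_ifs
    exacts [isProbabilityMeasure_bern hp0 hp1, isProbabilityMeasure_bern hq0 hq1]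
  unfold sbm
  infer_instance

/-- The pairs that join `v` to a vertex of `W`. -/
def incident {n : ℕ} (v : Fin n) (W : Finset (Fin n)) :
    Finset {e : Fin n × Fin n // e.1 < e.2} :=
  Finset.univ.filter fun e => (e.1.1 = v ∧ e.1.2 ∈ W) ∨ (e.1.2 = v ∧ e.1.1 ∈ W)

lemma sum_incident {n : ℕ} {v : Fin n} {W : Finset (Fin n)} (hv : v ∉ W)
    (f : {e : Fin n × Fin n // e.1 < e.2} → ℝ) (g : Fin n → ℝ)
    (h₁ : ∀ w (h : v < w), f ⟨(v, w), h⟩ = g w) (h₂ : ∀ w (h : w < v), f ⟨(w, v), h⟩ = g w) :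
    ∑ e ∈ incident v W, f e = ∑ w ∈ W, g w := by
  refine Finset.sum_nbij (fun e => if e.1.1 = v then e.1.2 else e.1.1) ?_ ?_ ?_ ?_
  · rintro ⟨⟨a, b⟩, hab⟩ he
    simp only [incident, Finset.mem_filter, Finset.mem_univ, true_and] at he
    dsimp only at hab he ⊢
    split_ifs with h
    · rcases he with he | he
      · exact he.2
      · exact absurd (h ▸ he.2) hv
    · exact (he.resolve_left fun h' => h h'.1).2
  · rintro ⟨⟨a, b⟩, hab⟩ he ⟨⟨a', b'⟩, hab'⟩ he' heq
    simp only [incident, Finset.coe_filter, Finset.mem_univ, true_and, Set.mem_ofPred_eq]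
      at he he'
    dsimp only at hab hab' he he' heq
    grind
  · intro w hw
    have hne : v ≠ w := fun h => hv (h ▸ hw)
    rcases lt_or_gt_of_ne hne with h | h
    · exact ⟨⟨(v, w), h⟩, by simpa [incident] using Or.inl hw, by simp⟩
    · exact ⟨⟨(w, v), h⟩, by simpa [incident] using Or.inr hw, by simp [hne.symm]⟩
  · rintro ⟨⟨a, b⟩, hab⟩ he
    simp only [incident, Finset.mem_filter, Finset.mem_univ, true_and] at he
    dsimp only at hab he ⊢
    split_ifs with h
    · subst h; exact h₁ b hab
    · obtain rfl := (he.resolve_left fun h' => h h'.1).1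
      exact h₂ a hab

lemma nbr_eq_sum_incident {n : ℕ} (G : {e : Fin n × Fin n // e.1 < e.2} → Bool)
    {v : Fin n} {W : Finset (Fin n)} (hv : v ∉ W) :
    ∑ e ∈ incident v W, ({true} : Set Bool).indicator (1 : Bool → ℝ) (G e) = nbr G W v := by
  rw [sum_incident hv _ (fun w => if adjB G w v = true then 1 else 0)]
  · simp [nbr]
  · intro w h
    simp [adjB, h, h.asymm, Set.indicator_apply]
  · intro w h
    simp [adjB, h, Set.indicator_apply]

lemma sbm_real_deviation {n k : ℕ} (hn : 0 < n) (c : Fin n → Fin k) {p q : ℝ} (hq : 0 ≤ q)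
    (hqp : q ≤ p) (hp : p ≤ 1) (hpn : 1 ≤ p * n) {W : Finset (Fin n)} {v : Fin n} (hv : v ∉ W)
    {τ : ℝ} (hτ : 10 * Real.sqrt (p * n) * Real.log n ≤ τ) :
    (sbm n k c p q).real {G | τ < |(nbr G W v : ℝ) -
      (q * W.card + (p - q) * (W.filter fun w => c w = c v).card)|} ≤ 6 / (n : ℝ) ^ 10 := by
  have hprob : ∀ e : {e : Fin n × Fin n // e.1 < e.2},
      IsProbabilityMeasure (bern (if c e.1.1 = c e.1.2 then p else q)) := by
    intro e
    split_ifs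
    exacts [isProbabilityMeasure_bern (hq.trans hqp) hp,
      isProbabilityMeasure_bern hq (hqp.trans hp)]
  have hmean : ∑ e ∈ incident v W, (bern (if c e.1.1 = c e.1.2 then p else q)).real {true} =
      ∑ w ∈ W, if c w = c v then p else q := by
    refine sum_incident hv _ _ (fun w h => ?_) fun w h => ?_
    · rw [bern_real_true (by dsimp only; split_ifs <;> linarith)]
      simp only [eq_comm]
    · rw [bern_real_true (by dsimp only; split_ifs <;> linarith)]
  have hmean' : (∑ w ∈ W, if c w = c v then p else q) =
      q * W.card + (p - q) * (W.filter fun w => c w = c v).card := by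
    have : ∀ w, (if c w = c v then p else q) = q + (p - q) * (if c w = c v then 1 else 0) := by
      intro w; split_ifs <;> ring
    simp_rw [this]
    rw [Finset.sum_add_distrib, ← Finset.mul_sum]
    simp [mul_comm]
  have h := pi_measureReal_deviation
    (fun e : {e : Fin n × Fin n // e.1 < e.2} => bern (if c e.1.1 = c e.1.2 then p else q))
    (incident v W) (A := fun _ => {true}) (fun _ => measurableSet_singleton _) hn
    (N := p * n) (τ := τ) hpn ?_ hτ
  · rw [hmean, hmean'] at h
    simp_rw [nbr_eq_sum_incident _ hv] at h
    exact h
  · rw [hmean]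
    calc (∑ w ∈ W, if c w = c v then p else q) ≤ ∑ w ∈ W, p := by
          gcongr; split_ifs <;> linarith
      _ = p * W.card := by simp [mul_comm]
      _ ≤ p * n := by
          have : (W.card : ℝ) ≤ n := by exact_mod_cast by simpa using W.card_le_univ
          have := hq.trans hqp
          gcongr

end Graph

section Sample

lemma unifOn_real {n : ℕ} (Y T : Finset (Fin n)) :
    (unifOn Y).real T = (Y ∩ T).card / Y.card := by
  rw [measureReal_def, unifOn]
  simp [Set.indicator_apply, div_eq_inv_mul]

lemma isProbabilityMeasure_unifOn {n : ℕ} {Y : Finset (Fin n)} (hY : Y.Nonempty) :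
    IsProbabilityMeasure (unifOn Y) := by
  refine ⟨?_⟩
  have : Y.card ≠ 0 := hY.card_ne_zero
  simp [unifOn, ENNReal.inv_mul_cancel, this]

/-- `h` uniform samples from `Y` almost surely lie in `Y` and hit `A ⊆ Y` except with probability
at most `exp (- h * |A| / |Y|)`. -/
lemma one_sub_exp_le_pi_unifOn {n : ℕ} (h : ℕ) {Y A : Finset (Fin n)} (hY : Y.Nonempty)
    (hA : A ⊆ Y) :
    1 - Real.exp (-(h * (A.card / Y.card))) ≤
      (Measure.pi fun _ : Fin h => unifOn Y).real {u | (∀ j, u j ∈ Y) ∧ ∃ j, u j ∈ A} := by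
  have := isProbabilityMeasure_unifOn hY
  have hY0 : (0 : ℝ) < Y.card := by exact_mod_cast hY.card_pos
  have hpi : ∀ T : Finset (Fin n), (Measure.pi fun _ : Fin h => unifOn Y).real
      (Set.univ.pi fun _ => (T : Set (Fin n))) = ((Y ∩ T).card / Y.card : ℝ) ^ h := by
    intro T
    rw [measureReal_def, Measure.pi_pi]
    simp [← unifOn_real, measureReal_def]
  have hset : {u : Fin h → Fin n | (∀ j, u j ∈ Y) ∧ ∃ j, u j ∈ A} =
      (Set.univ.pi fun _ => (Y : Set (Fin n))) \
        (Set.univ.pi fun _ => ((Y \ A : Finset (Fin n)) : Set (Fin n))) := by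
    ext u
    simp only [Set.mem_ofPred_eq, Set.mem_sdiff, Set.mem_univ_pi, Finset.mem_coe,
      Finset.mem_sdiff, not_forall]
    grind
  have hcard : ((Y ∩ (Y \ A)).card : ℝ) = Y.card - A.card := by
    rw [Finset.inter_eq_right.2 Finset.sdiff_subset, Finset.card_sdiff_of_subset hA,
      Nat.cast_sub (Finset.card_le_card hA)]
  rw [hset, measureReal_sdiff (Set.pi_mono fun _ _ => by simp) (MeasurableSet.of_discrete),
    hpi, hpi, Finset.inter_self, div_self hY0.ne', one_pow, hcard]
  have hle : (A.card : ℝ) ≤ Y.card := by exact_mod_cast Finset.card_le_card hA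
  gcongr
  rw [← mul_neg, Real.exp_nat_mul]
  gcongr
  rw [sub_div, div_self hY0.ne']
  exact Real.one_sub_le_exp_neg _

end Sample

section Assembly

lemma one_sub_card_mul_le_real_forall {Ω ι : Type*} [Fintype ι] [MeasurableSpace Ω]
    [DiscreteMeasurableSpace Ω] (μ : Measure Ω) [IsProbabilityMeasure μ] {P : ι → Ω → Prop}
    {b : ℝ} (h : ∀ i, μ.real {x | ¬ P i x} ≤ b) :
    1 - Fintype.card ι * b ≤ μ.real {x | ∀ i, P i x} := by
  have hset : {x | ∀ i, P i x} = (⋃ i, {x | ¬ P i x})ᶜ := by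
    ext x; simp
  rw [hset, probReal_compl_eq_one_sub MeasurableSet.of_discrete]
  gcongr
  calc _ ≤ _ := measureReal_iUnion_fintype_le _
    _ ≤ ∑ _i : ι, b := by gcongr with i; exact h i
    _ = _ := by simp

lemma ofReal_le_estMeasure {n k h : ℕ} {c : Fin n → Fin k} {p q : ℝ}
    [IsProbabilityMeasure (sbm n k c p q)]
    {E : Set ((Fin n → Fin 3) × (({e : Fin n × Fin n // e.1 < e.2} → Bool) × (Fin h → Fin n)))}
    {L : Set (Fin n → Fin 3)} {A : (Fin n → Fin 3) → Set ({e : Fin n × Fin n // e.1 < e.2} → Bool)}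
    {B : (Fin n → Fin 3) → Set (Fin h → Fin n)} {a₁ a₂ a₃ : ℝ} (ha₁ : 0 ≤ a₁) (ha₂ : 0 ≤ a₂)
    (hY : ∀ lab ∈ L, (Y2 lab).Nonempty) (hL : a₁ ≤ (labelM n).real L)
    (hA : ∀ lab ∈ L, a₂ ≤ (sbm n k c p q).real (A lab))
    (hB : ∀ lab ∈ L, a₃ ≤ (Measure.pi fun _ : Fin h => unifOn (Y2 lab)).real (B lab))
    (hE : ∀ lab ∈ L, ∀ G ∈ A lab, ∀ u ∈ B lab, (lab, G, u) ∈ E) :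
    ENNReal.ofReal (a₁ * (a₂ * a₃)) ≤ estMeasure n k h c p q E := by
  rw [estMeasure, Measure.bind_apply MeasurableSet.of_discrete
    Measurable.of_discrete.aemeasurable]
  calc ENNReal.ofReal (a₁ * (a₂ * a₃)) = ENNReal.ofReal (a₂ * a₃) * ENNReal.ofReal a₁ := by
        rw [ENNReal.ofReal_mul ha₁, mul_comm]
    _ ≤ ENNReal.ofReal (a₂ * a₃) * labelM n L := by
        gcongr
        rw [← ofReal_measureReal]
        exact ENNReal.ofReal_le_ofReal hL
    _ = ∫⁻ lab, L.indicator (fun _ => ENNReal.ofReal (a₂ * a₃)) lab ∂(labelM n) := by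
        rw [lintegral_indicator_const MeasurableSet.of_discrete]
    _ ≤ _ := lintegral_mono fun lab => ?_
  by_cases hlab : lab ∈ L
  · have := isProbabilityMeasure_unifOn (hY lab hlab)
    simp only [Set.indicator_of_mem hlab]
    rw [Measure.map_apply Measurable.of_discrete MeasurableSet.of_discrete,
      ENNReal.ofReal_mul ha₂]
    calc _ ≤ ENNReal.ofReal ((sbm n k c p q).real (A lab)) *
          ENNReal.ofReal ((Measure.pi fun _ : Fin h => unifOn (Y2 lab)).real (B lab)) := by
          gcongr
          exacts [hA lab hlab, hB lab hlab]
      _ = ((sbm n k c p q).prod (Measure.pi fun _ : Fin h => unifOn (Y2 lab)))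
            (A lab ×ˢ B lab) := by
          rw [ofReal_measureReal, ofReal_measureReal, Measure.prod_prod]
      _ ≤ _ := measure_mono fun x hx => hE lab hlab x.1 hx.1 x.2 hx.2
  · simp [hlab]

lemma sq_sigSBM_le {p q : ℝ} (hq : 0 ≤ q) (hqp : q ≤ p) : sigSBM p q ^ 2 ≤ p := by
  have hp := hq.trans hqp
  have h : sigSBM p q ≤ Real.sqrt p := by
    refine max_le ?_ ?_ <;> refine Real.sqrt_le_sqrt ?_ <;> nlinarith
  calc sigSBM p q ^ 2 ≤ Real.sqrt p ^ 2 := by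
        have : 0 ≤ sigSBM p q := le_max_of_le_left (Real.sqrt_nonneg _)
        gcongr
    _ = p := Real.sq_sqrt hp

lemma mul_sqrt_mul_log_le_of_sbar_le {n : ℕ} {p q s : ℝ} (hq : 0 ≤ q) (hqp : q < p)
    (hp : p ≤ 3 / 4) (hs : sbar n p q ≤ s) :
    2 ^ 12 * Real.sqrt (p * n) * Real.log n ≤ (p - q) * s ∧
      2 ^ 13 * Real.sqrt n * Real.log n ≤ s := by
  have hpq : 0 < p - q := sub_pos.2 hqp
  have hn : (0 : ℝ) ≤ n := n.cast_nonneg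
  have hlog : 0 ≤ Real.log n := Real.log_natCast_nonneg n
  rw [sbar, div_le_iff₀ hpq] at hs
  have h₁ : Real.sqrt (p * n) ≤ 2 * Real.sqrt (p * (1 - q) * n) := by
    rw [← Real.sqrt_sq (zero_le_two (α := ℝ)), ← Real.sqrt_mul (sq_nonneg _)]
    refine Real.sqrt_le_sqrt ?_
    have : 0 ≤ p * n := mul_nonneg (hq.trans hqp.le) hn
    nlinarith
  have h₂ : (p - q) * Real.sqrt n ≤ Real.sqrt (p * (1 - q) * n) := by
    rw [← Real.sqrt_sq hpq.le, ← Real.sqrt_mul (sq_nonneg _)]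
    refine Real.sqrt_le_sqrt (mul_le_mul_of_nonneg_right ?_ hn)
    nlinarith
  constructor
  · nlinarith [mul_le_mul_of_nonneg_right h₁ hlog]
  · refine le_of_mul_le_mul_right ?_ hpq
    nlinarith [mul_le_mul_of_nonneg_right h₂ hlog]

lemma exists_card_clusterF_eq_smax {n k : ℕ} (c : Fin n → Fin k) (hs : 0 < smax c) :
    ∃ v, (clusterF c (c v)).card = smax c := by
  have hne : (Finset.univ : Finset (Fin k)).Nonempty := by
    by_contra h
    simp [smax, Finset.not_nonempty_iff_eq_empty.1 h] at hs
  obtain ⟨i, -, hi⟩ := Finset.exists_mem_eq_sup _ hne fun i => (clusterF c i).card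
  change smax c = _ at hi
  obtain ⟨v, hv⟩ := Finset.card_pos.1 (hi ▸ hs)
  exact ⟨v, by rw [(Finset.mem_filter.1 hv).2, hi]⟩

lemma card_clusterF_le_smax {n k : ℕ} (c : Fin n → Fin k) (i : Fin k) :
    (clusterF c i).card ≤ smax c :=
  Finset.le_sup (f := fun i => (clusterF c i).card) (Finset.mem_univ i)

/-- If the cluster sizes inside `W` and the degrees into `W` are close to their means and some
sampled vertex lies in the largest cluster, every maximizer yields a good estimate. -/
lemma estimate_of_concentration {n k h : ℕ} {c : Fin n → Fin k} {p q : ℝ} (hqp : q < p)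
    {W : Finset (Fin n)} {G : {e : Fin n × Fin n // e.1 < e.2} → Bool} {u : Fin h → Fin n}
    {v₀ : Fin n} (hv₀ : (clusterF c (c v₀)).card = smax c)
    (hW : ∀ v, |((W.filter fun w => c w = c v).card : ℝ) - (clusterF c (c v)).card / 2| ≤
      0.01 * smax c)
    (hG : ∀ v, v ∉ W → |(nbr G W v : ℝ) -
      (q * W.card + (p - q) * (W.filter fun w => c w = c v).card)| ≤ 0.01 * ((p - q) * smax c))
    (hu : ∀ j, u j ∉ W) (hhit : ∃ j, c (u j) = c v₀) {j : Fin h}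
    (hj : ∀ j', nbr G W (u j') ≤ nbr G W (u j)) :
    0.48 * (smax c : ℝ) ≤ ((nbr G W (u j) : ℝ) - q * W.card) / (p - q) ∧
      ((nbr G W (u j) : ℝ) - q * W.card) / (p - q) ≤ 0.52 * smax c := by
  have hpq : 0 < p - q := sub_pos.2 hqp
  rw [le_div_iff₀ hpq, div_le_iff₀ hpq]
  constructor
  · obtain ⟨j₀, hj₀⟩ := hhit
    have h₁ := (abs_le.1 (hW (u j₀))).1
    have h₂ := (abs_le.1 (hG _ (hu j₀))).1
    have h₃ : (nbr G W (u j₀) : ℝ) ≤ nbr G W (u j) := by exact_mod_cast hj j₀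
    rw [hj₀, hv₀] at h₁
    rw [hj₀] at h₂
    nlinarith [mul_le_mul_of_nonneg_left h₁ hpq.le]
  · have h₁ := (abs_le.1 (hW (u j))).2
    have h₂ := (abs_le.1 (hG _ (hu j))).2
    have h₃ : ((clusterF c (c (u j))).card : ℝ) ≤ smax c := by
      exact_mod_cast card_clusterF_le_smax c _
    have h₄ : ((W.filter fun w => c w = c (u j)).card : ℝ) ≤ 0.51 * smax c := by linarith
    nlinarith [mul_le_mul_of_nonneg_left h₄ hpq.le]

end Assembly

/-- There are absolute constants `C₀ > 0`, `n₀` (and `C > 0` for the `O(·)`)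
such that for all `n ≥ n₀`, `0 < q < p ≤ 3/4` with `σ² ≥ C₀ log n / n` and `s_max ≥ s̄`:
placing vertices independently into `Y₂` (prob. `1/8`), `W` (prob. `1/2`) or elsewhere, sampling
`h = ⌈√n·log n⌉` vertices `u₁,…,u_h` i.i.d. uniformly from `Y₂`, picking a sampled vertex `u`
maximizing `N_W(u_i)`, and setting `s′ := (N_W(u) − q|W|)/(p−q)`, with probability at least
`1 − C·n^{−8}` one has `0.48·s_max ≤ s′ ≤ 0.52·s_max` (for every choice of maximizer `u`). -/
theorem statement_17 :
    ∃ (C₀ C : ℝ) (n₀ : ℕ), 0 < C₀ ∧ 0 < C ∧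
      ∀ (n k : ℕ), n₀ ≤ n →
        ∀ p q : ℝ, 0 < q → q < p → p ≤ 3 / 4 →
          C₀ * Real.log n / n ≤ (sigSBM p q) ^ 2 →
          ∀ c : Fin n → Fin k,
            sbar n p q ≤ (smax c : ℝ) →
            ENNReal.ofReal (1 - C / (n : ℝ) ^ 8) ≤
              estMeasure n k (⌈Real.sqrt n * Real.log n⌉₊) c p q
                {ω | ∀ j,
                  (∀ j', nbr ω.2.1 (Wset ω.1) (ω.2.2 j') ≤ nbr ω.2.1 (Wset ω.1) (ω.2.2 j)) →
                  0.48 * (smax c : ℝ) ≤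
                      ((nbr ω.2.1 (Wset ω.1) (ω.2.2 j) : ℝ) - q * ((Wset ω.1).card : ℝ)) /
                        (p - q) ∧
                    ((nbr ω.2.1 (Wset ω.1) (ω.2.2 j) : ℝ) - q * ((Wset ω.1).card : ℝ)) /
                        (p - q) ≤ 0.52 * (smax c : ℝ)} := by
  refine ⟨1, 25, 3, one_pos, by norm_num, ?_⟩
  intro n k hn p q hq hqp hp hσ c hs
  have hn0 : 0 < n := by omega
  have hnR : (3 : ℝ) ≤ n := by exact_mod_cast hn
  have hnpos : (0 : ℝ) < n := by linarith
  have hlog : 1 ≤ Real.log n :=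
    (Real.le_log_iff_exp_le hnpos).2 (Real.exp_one_lt_three.le.trans hnR)
  have hpn : 1 ≤ p * n := by
    have := hσ.trans (sq_sigSBM_le hq.le hqp.le)
    rw [div_le_iff₀ hnpos] at this
    linarith
  obtain ⟨hs₁, hs₂⟩ := mul_sqrt_mul_log_le_of_sbar_le hq.le hqp hp hs
  have hsqrt : 0 < Real.sqrt n := Real.sqrt_pos.2 hnpos
  have hsqlog : 0 < Real.sqrt n * Real.log n := by positivity
  have hsqlog' : 0 ≤ Real.sqrt (p * n) * Real.log n := by positivity
  have hspos : (0 : ℝ) < smax c := by linarith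
  obtain ⟨v₀, hv₀⟩ := exists_card_clusterF_eq_smax c (by exact_mod_cast hspos)
  have hprob := isProbabilityMeasure_sbm c (hq.trans hqp).le (by linarith : p ≤ 1) hq.le
    (by linarith : q ≤ 1)
  set L : Set (Fin n → Fin 3) := {lab | ∀ i : Fin n × Fin 3,
    |(((clusterF c (c i.1)).filter fun w => lab w = i.2).card : ℝ) -
      (clusterF c (c i.1)).card * vertexLabelM.real {i.2}| ≤ 0.01 * smax c} with hL_def
  have hL : 1 - (Fintype.card (Fin n × Fin 3) : ℝ) * (6 / (n : ℝ) ^ 10) ≤ (labelM n).real L := by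
    refine one_sub_card_mul_le_real_forall _ fun i => ?_
    simp only [not_le]
    exact labelM_real_deviation hn0 _ _ (by linarith)
  have hLW : ∀ lab ∈ L, ∀ v, |(((Wset lab).filter fun w => c w = c v).card : ℝ) -
      (clusterF c (c v)).card / 2| ≤ 0.01 * smax c := by
    intro lab hlab v
    have := hlab (v, 1)
    simp only [vertexLabelM_real_one] at this
    rw [Wset, Finset.filter_comm, div_eq_mul_one_div]
    exact this
  have hLY : ∀ lab ∈ L, 0.11 * (smax c : ℝ) ≤
      ((clusterF c (c v₀)).filter fun w => lab w = 0).card := by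
    intro lab hlab
    have := hlab (v₀, 0)
    simp only [vertexLabelM_real_zero, hv₀] at this
    have := (abs_le.1 this).1
    linarith
  have hsub : ∀ lab : Fin n → Fin 3, ((clusterF c (c v₀)).filter fun w => lab w = 0) ⊆ Y2 lab :=
    fun lab => Finset.filter_subset_filter _ (Finset.subset_univ _)
  have hY : ∀ lab ∈ L, (Y2 lab).Nonempty := by
    intro lab hlab
    refine Finset.Nonempty.mono (hsub lab) (Finset.card_pos.1 ?_)
    have := hLY lab hlab
    exact_mod_cast (by linarith : (0 : ℝ) < 0.11 * smax c).trans_le this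
  have hA : ∀ lab ∈ L, 1 - (Fintype.card (Fin n) : ℝ) * (6 / (n : ℝ) ^ 10) ≤
      (sbm n k c p q).real {G | ∀ v, v ∉ Wset lab → |(nbr G (Wset lab) v : ℝ) -
        (q * (Wset lab).card + (p - q) * ((Wset lab).filter fun w => c w = c v).card)| ≤
          0.01 * ((p - q) * smax c)} := by
    intro lab _
    refine one_sub_card_mul_le_real_forall _ fun v => ?_
    by_cases hv : v ∈ Wset lab
    · simp only [hv, not_true_eq_false, false_imp_iff]
      simp only [Set.ofPred_false, measureReal_empty]
      positivity
    · simp only [hv, not_false_eq_true, true_imp_iff, not_le]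
      exact sbm_real_deviation hn0 c hq.le hqp.le (by linarith) hpn hv (by linarith)
  have hB : ∀ lab ∈ L, 1 - 1 / (n : ℝ) ^ 10 ≤
      (Measure.pi fun _ : Fin ⌈Real.sqrt n * Real.log n⌉₊ => unifOn (Y2 lab)).real
        {u | (∀ j, u j ∈ Y2 lab) ∧
          ∃ j, u j ∈ (clusterF c (c v₀)).filter fun w => lab w = 0} := by
    intro lab hlab
    refine le_trans ?_ (one_sub_exp_le_pi_unifOn _ (hY lab hlab) (hsub lab))
    rw [one_div, ← Real.exp_log (show (0 : ℝ) < n ^ 10 by positivity), ← Real.exp_neg,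
      Real.log_pow]
    refine sub_le_sub_left (Real.exp_le_exp.2 (neg_le_neg ?_)) _
    have hYn : ((Y2 lab).card : ℝ) ≤ n := by
      exact_mod_cast by simpa using (Y2 lab).card_le_univ
    have hY0 : (0 : ℝ) < (Y2 lab).card := by exact_mod_cast (hY lab hlab).card_pos
    have hsq : Real.sqrt n * Real.sqrt n = n := Real.mul_self_sqrt hnpos.le
    calc ((10 : ℕ) : ℝ) * Real.log n
        ≤ (Real.sqrt n * Real.log n) * (10 * Real.sqrt n * Real.log n / n) := by
          rw [mul_div_assoc', le_div_iff₀ hnpos]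
          push_cast
          calc 10 * Real.log n * n = 10 * (Real.log n * 1) * (Real.sqrt n * Real.sqrt n) := by
                rw [hsq, mul_one]
            _ ≤ 10 * (Real.log n * Real.log n) * (Real.sqrt n * Real.sqrt n) := by gcongr
            _ = _ := by ring
      _ ≤ _ := by
          gcongr
          · exact Nat.le_ceil _
          · have := hLY lab hlab
            linarith
  have ha : ∀ m : ℝ, m ≤ 3 * n → 0 ≤ 1 - m * (6 / (n : ℝ) ^ 10) := by
    intro m hm
    rw [sub_nonneg, mul_div_assoc', div_le_one (by positivity)]
    calc m * 6 ≤ 3 * n * 6 := by gcongr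
      _ ≤ n * 3 ^ 9 := by nlinarith
      _ ≤ n * (n : ℝ) ^ 9 := by gcongr
      _ = (n : ℝ) ^ 10 := by ring
  have ha₁ := ha (Fintype.card (Fin n × Fin 3)) (by simp [mul_comm])
  have ha₂ := ha (Fintype.card (Fin n)) (by simp; linarith)
  refine le_trans (ENNReal.ofReal_le_ofReal ?_) (ofReal_le_estMeasure ha₁ ha₂ hY hL hA hB ?_)
  · have h₁ : 1 / (n : ℝ) ^ 9 ≤ 1 / (n : ℝ) ^ 8 := by
      gcongr
      · linarith
      · norm_num
    have h₂ : 1 / (n : ℝ) ^ 10 ≤ 1 / (n : ℝ) ^ 9 := by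
      gcongr
      · linarith
      · norm_num
    have h₃ : (n : ℝ) * (6 / (n : ℝ) ^ 10) = 6 * (1 / (n : ℝ) ^ 9) := by
      field_simp
    have h₀ : 0 ≤ 1 / (n : ℝ) ^ 10 := by positivity
    have h₄ : 1 / (n : ℝ) ^ 10 ≤ 1 := (div_le_one (by positivity)).2 (one_le_pow₀ (by linarith))
    simp only [Fintype.card_prod, Fintype.card_fin, Nat.cast_mul] at ha₁ ha₂ ⊢
    push_cast at ha₁ ha₂ ⊢
    rw [show (n : ℝ) * 3 * (6 / (n : ℝ) ^ 10) = 18 * (1 / (n : ℝ) ^ 9) by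
      rw [mul_right_comm, h₃]; ring] at ha₁ ⊢
    rw [h₃] at ha₂ ⊢
    rw [show 25 / (n : ℝ) ^ 8 = 25 * (1 / (n : ℝ) ^ 8) by ring]
    set x := 1 / (n : ℝ) ^ 9
    set y := 1 / (n : ℝ) ^ 10
    have hx : 0 ≤ x := h₀.trans h₂
    nlinarith [mul_nonneg (mul_nonneg hx hx) (sub_nonneg.2 h₄), mul_nonneg hx h₀]
  · intro lab hlab G hG u hu j hj
    refine estimate_of_concentration hqp hv₀ (hLW lab hlab) hG (fun j => ?_) ?_ hj
    · have := (Finset.mem_filter.1 (hu.1 j)).2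
      simp [Wset, this]
    · obtain ⟨j, hj⟩ := hu.2
      exact ⟨j, (Finset.mem_filter.1 (Finset.mem_filter.1 hj).1).2⟩
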